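/- arXiv:2405.05436 — 7 statements merged into one kernel-verified Lean document; each statement's English description precedes it below -/
import Mathlib

section
/- Suppose m ∈ (0, ε]. Then |q₂(m)| < exp(ε ∑_{j=1}^{n₂} 1/|η_j|) · |q₂(0)| and |p₁(m)| < ε · |p₁'(ε)|, where p₁' denotes the derivative of p₁. -/
/-- Lemma 2, first case, of "On the approximation properties of
fast Leja points".  Setup: `ζ₁ < ⋯ < ζ_{n₁} < -ε < ε < η₁ < ⋯ < η_{n₂}`,
`q₁(z) = ∏ (z - ζ_j)`, `q₂(z) = ∏ (z - η_j)`, `p₁ = (z² - ε²) q₁`,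
`p = (z² - ε²) q₁ q₂`, and `m ∈ I = [-ε, ε]` maximizes `|p|` on `I`.
If `m ∈ (0, ε]` then `|q₂(m)| < exp(ε ∑ 1/|η_j|)·|q₂(0)|` and `|p₁(m)| < ε·|p₁'(ε)|`. -/
theorem stmt_0
    (n₁ n₂ : ℕ) (hn₁ : 1 ≤ n₁) (hn₂ : 1 ≤ n₂)
    (ε : ℝ) (hε : 0 < ε)
    (ζ : Fin n₁ → ℝ) (η : Fin n₂ → ℝ)
    (hζmono : StrictMono ζ) (hηmono : StrictMono η)
    (hζ : ∀ j, ζ j < -ε) (hη : ∀ j, ε < η j)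
    (q₁ q₂ p₁ p : ℝ → ℝ)
    (hq₁ : q₁ = fun x => ∏ j, (x - ζ j))
    (hq₂ : q₂ = fun x => ∏ j, (x - η j))
    (hp₁ : p₁ = fun x => (x ^ 2 - ε ^ 2) * q₁ x)
    (hp : p = fun x => (x ^ 2 - ε ^ 2) * q₁ x * q₂ x)
    (m : ℝ) (hm : m ∈ Set.Icc (-ε) ε)
    (hmax : ∀ x ∈ Set.Icc (-ε) ε, |p x| ≤ |p m|)
    (hm' : m ∈ Set.Ioc 0 ε) :
    |q₂ m| < Real.exp (ε * ∑ j, 1 / |η j|) * |q₂ 0| ∧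
      |p₁ m| < ε * |deriv p₁ ε| := by
  obtain ⟨hm0, hmε⟩ := hm'
  have hη0 : ∀ j, 0 < η j := fun j => hε.trans (hη j)
  constructor
  · have hle : |q₂ m| ≤ |q₂ 0| := by
      simp only [hq₂, Finset.abs_prod]
      refine Finset.prod_le_prod (fun j _ => abs_nonneg _) fun j _ => ?_
      rw [abs_of_neg (by linarith [hη j]), abs_of_neg (by linarith [hη j])]
      linarith
    have hpos : 0 < |q₂ 0| := by
      rw [abs_pos, hq₂]
      exact Finset.prod_ne_zero_iff.mpr fun j _ => by linarith [hη0 j]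
    have hsum : 0 < ∑ j, 1 / |η j| := by
      refine Finset.sum_pos (fun j _ => one_div_pos.mpr (abs_pos.mpr (hη0 j).ne')) ?_
      exact ⟨⟨0, hn₂⟩, Finset.mem_univ _⟩
    exact hle.trans_lt (lt_mul_of_one_lt_left hpos (Real.one_lt_exp_iff.mpr (mul_pos hε hsum)))
  · have hdiff : DifferentiableAt ℝ q₁ ε := by
      rw [hq₁]
      fun_prop
    have hderiv : deriv p₁ ε = 2 * ε * q₁ ε := by
      have hsq : HasDerivAt (fun x : ℝ => x ^ 2 - ε ^ 2) (2 * ε) ε := by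
        simpa using (hasDerivAt_pow 2 ε).sub_const (ε ^ 2)
      rw [hp₁]
      refine (hsq.mul hdiff.hasDerivAt).deriv.trans ?_
      ring
    have hle : |q₁ m| ≤ |q₁ ε| := by
      simp only [hq₁, Finset.abs_prod]
      refine Finset.prod_le_prod (fun j _ => abs_nonneg _) fun j _ => ?_
      rw [abs_of_pos (by linarith [hζ j]), abs_of_pos (by linarith [hζ j])]
      linarith
    have hpos : 0 < |q₁ ε| := by
      rw [abs_pos, hq₁]
      exact Finset.prod_ne_zero_iff.mpr fun j _ => by linarith [hζ j]
    have hsq : |m ^ 2 - ε ^ 2| ≤ ε ^ 2 := by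
      rw [abs_le]
      constructor <;> nlinarith
    calc |p₁ m| = |m ^ 2 - ε ^ 2| * |q₁ m| := by rw [hp₁, abs_mul]
      _ ≤ ε ^ 2 * |q₁ ε| := by gcongr
      _ < 2 * (ε ^ 2 * |q₁ ε|) := by linarith [mul_pos (pow_pos hε 2) hpos]
      _ = ε * |deriv p₁ ε| := by
        rw [hderiv, abs_mul, abs_of_pos (by positivity : 0 < 2 * ε)]
        ring
end

section
/- Suppose m ∈ [−ε, 0). Then |q₁(m)| < exp(ε ∑_{j=1}^{n₂} 1/|η_j|) · |q₁(0)| and |p₂(m)| < ε · |p₂'(−ε)|, where p₂' denotes the derivative of p₂. -/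
/-- At a root `a` of its first factor, the product `(x² - a²) q` has derivative `2 a q(a)`. -/
theorem hasDerivAt_sq_sub_sq_mul {q : ℝ → ℝ} {a : ℝ} (hq : DifferentiableAt ℝ q a) :
    HasDerivAt (fun x => (x ^ 2 - a ^ 2) * q x) (2 * a * q a) a :=
  (((hasDerivAt_pow 2 a).sub_const (a ^ 2)).mul hq.hasDerivAt).congr_deriv (by simp)

/-- Lemma 2, second case.  Same setup as Statement 0, with
`p₂ = (z² - ε²) q₂`.  If `m ∈ [-ε, 0)` then
`|q₁(m)| < exp(ε ∑ 1/|η_j|)·|q₁(0)|` and `|p₂(m)| < ε·|p₂'(-ε)|`. -/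
theorem stmt_1
    (n₁ n₂ : ℕ) (hn₁ : 1 ≤ n₁) (hn₂ : 1 ≤ n₂)
    (ε : ℝ) (hε : 0 < ε)
    (ζ : Fin n₁ → ℝ) (η : Fin n₂ → ℝ)
    (hζmono : StrictMono ζ) (hηmono : StrictMono η)
    (hζ : ∀ j, ζ j < -ε) (hη : ∀ j, ε < η j)
    (q₁ q₂ p₂ p : ℝ → ℝ)
    (hq₁ : q₁ = fun x => ∏ j, (x - ζ j))
    (hq₂ : q₂ = fun x => ∏ j, (x - η j))
    (hp₂ : p₂ = fun x => (x ^ 2 - ε ^ 2) * q₂ x)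
    (hp : p = fun x => (x ^ 2 - ε ^ 2) * q₁ x * q₂ x)
    (m : ℝ) (hm : m ∈ Set.Icc (-ε) ε)
    (hmax : ∀ x ∈ Set.Icc (-ε) ε, |p x| ≤ |p m|)
    (hm' : m ∈ Set.Ico (-ε) 0) :
    |q₁ m| < Real.exp (ε * ∑ j, 1 / |η j|) * |q₁ 0| ∧
      |p₂ m| < ε * |deriv p₂ (-ε)| := by
  obtain ⟨hm₁, hm₂⟩ := hm'
  subst hq₁ hq₂ hp₂
  constructor
  · have h₁ : |∏ j, (m - ζ j)| < |∏ j, (0 - ζ j)| := by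
      have : Nonempty (Fin n₁) := ⟨⟨0, hn₁⟩⟩
      have hpos : ∀ j, 0 < m - ζ j := fun j => by linarith [hζ j]
      rw [abs_of_pos (Finset.prod_pos fun j _ => hpos j),
        abs_of_pos (Finset.prod_pos fun j _ => by linarith [hpos j])]
      exact Finset.prod_lt_prod_of_nonempty (fun j _ => hpos j) (fun j _ => by linarith)
        Finset.univ_nonempty
    have h₂ : 1 ≤ Real.exp (ε * ∑ j, 1 / |η j|) := Real.one_le_exp (by positivity)
    exact h₁.trans_le (le_mul_of_one_le_left (abs_nonneg _) h₂)
  · have hd : deriv (fun x => (x ^ 2 - ε ^ 2) * ∏ j, (x - η j)) (-ε)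
        = 2 * -ε * ∏ j, (-ε - η j) := by
      have h := hasDerivAt_sq_sub_sq_mul (a := -ε) (q := fun x => ∏ j, (x - η j)) (by fun_prop)
      rw [neg_sq] at h
      exact h.deriv
    have hq : |∏ j, (m - η j)| ≤ |∏ j, (-ε - η j)| := by
      rw [Finset.abs_prod, Finset.abs_prod]
      refine Finset.prod_le_prod (fun j _ => abs_nonneg _) fun j _ => ?_
      rw [abs_of_neg (by linarith [hη j]), abs_of_neg (by linarith [hη j])]
      linarith
    have hq_pos : 0 < |∏ j, (-ε - η j)| :=
      abs_pos.2 (Finset.prod_ne_zero_iff.2 fun j _ => by linarith [hη j])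
    have hsq : |m ^ 2 - ε ^ 2| ≤ ε ^ 2 := by
      rw [abs_le]
      constructor <;> nlinarith
    rw [hd]
    simp only [abs_mul, abs_neg, abs_two, abs_of_pos hε]
    calc |m ^ 2 - ε ^ 2| * |∏ j, (m - η j)|
        ≤ ε ^ 2 * |∏ j, (-ε - η j)| := by gcongr
      _ < ε * (2 * ε * |∏ j, (-ε - η j)|) := by nlinarith [mul_pos (pow_pos hε 2) hq_pos]
end

section
/- The supremum of |p| over I = [−ε, ε] satisfies (sup_{x∈I} |p(x)|) / |p(0)| ≤ 2 · exp(ε ∑_{j=1}^{n} 1/|z_j|), where z₁ < z₂ < ⋯ < z_n is the full list of the n = n₁ + n₂ + 2 roots of p (namely ζ₁, …, ζ_{n₁}, −ε, ε, η₁, …, η_{n₂}). Note that p(0) ≠ 0 since 0 is not a root of p. -/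
/-- For `|x| ≤ ε`, moving from `0` to `x` enlarges a product of linear factors with nonzero
roots `z j` by at most a factor `exp (ε ∑ 1 / |z j|)`. -/
theorem abs_prod_sub_le {ι : Type*} [Fintype ι] {x ε : ℝ} (hx : |x| ≤ ε) (z : ι → ℝ)
    (hz : ∀ j, z j ≠ 0) :
    |∏ j, (x - z j)| ≤ |∏ j, (0 - z j)| * Real.exp (ε * ∑ j, 1 / |z j|) := by
  rw [Finset.abs_prod, Finset.abs_prod, Finset.mul_sum, Real.exp_sum, ← Finset.prod_mul_distrib]
  refine Finset.prod_le_prod (fun _ _ => abs_nonneg _) fun j _ => ?_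
  have hpos : 0 < |z j| := abs_pos.mpr (hz j)
  calc |x - z j| ≤ |x| + |z j| := abs_sub _ _
    _ ≤ |z j| * (ε * (1 / |z j|) + 1) := by
      have : |z j| * (ε * (1 / |z j|) + 1) = ε + |z j| := by field_simp
      linarith
    _ ≤ |0 - z j| * Real.exp (ε * (1 / |z j|)) := by
      rw [zero_sub, abs_neg]
      gcongr
      exact Real.add_one_le_exp _

/-- Proposition 3.  With
`ζ₁ < ⋯ < ζ_{n₁} < -ε < ε < η₁ < ⋯ < η_{n₂}` and
`p(z) = (z² - ε²) ∏ (z - ζ_j) ∏ (z - η_j)`, the sup of `|p|` over `I = [-ε, ε]`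
satisfies `(sup_I |p|) / |p(0)| ≤ 2 exp(ε ∑_{roots z} 1/|z|)`, the sum running
over all `n = n₁ + n₂ + 2` roots `ζ₁, …, ζ_{n₁}, -ε, ε, η₁, …, η_{n₂}` of `p`. -/
theorem stmt_2
    (n₁ n₂ : ℕ) (hn₁ : 1 ≤ n₁) (hn₂ : 1 ≤ n₂)
    (ε : ℝ) (hε : 0 < ε)
    (ζ : Fin n₁ → ℝ) (η : Fin n₂ → ℝ)
    (hζmono : StrictMono ζ) (hηmono : StrictMono η)
    (hζ : ∀ j, ζ j < -ε) (hη : ∀ j, ε < η j)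
    (p : ℝ → ℝ)
    (hp : p = fun x => (x ^ 2 - ε ^ 2) * (∏ j, (x - ζ j)) * ∏ j, (x - η j)) :
    (⨆ x ∈ Set.Icc (-ε) ε, |p x|) / |p 0| ≤
      2 * Real.exp (ε * ((∑ j, 1 / |ζ j|) + 1 / |(-ε)| + 1 / |ε| + ∑ j, 1 / |η j|)) := by
  have hζ0 : ∀ j, ζ j ≠ 0 := fun j => ((hζ j).trans (neg_neg_of_pos hε)).ne
  have hη0 : ∀ j, η j ≠ 0 := fun j => (hε.trans (hη j)).ne'
  have hp0 : 0 < |p 0| := by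
    rw [abs_pos, hp]
    simp [Finset.prod_ne_zero_iff, hζ0, hη0, hε.ne']
  rw [div_le_iff₀ hp0]
  refine Real.iSup_le (fun x => Real.iSup_le (fun hx => ?_) (by positivity)) (by positivity)
  have hxε : |x| ≤ ε := abs_le.mpr hx
  have hquad : |x ^ 2 - ε ^ 2| ≤ |0 ^ 2 - ε ^ 2| := by
    have hsq : x ^ 2 ≤ ε ^ 2 := sq_le_sq' hx.1 hx.2
    rw [abs_of_nonpos (by linarith), abs_of_nonpos (by nlinarith)]
    nlinarith
  calc |p x| = |x ^ 2 - ε ^ 2| * |∏ j, (x - ζ j)| * |∏ j, (x - η j)| := by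
        rw [hp, abs_mul, abs_mul]
    _ ≤ |0 ^ 2 - ε ^ 2| * (|∏ j, (0 - ζ j)| * Real.exp (ε * ∑ j, 1 / |ζ j|)) *
          (|∏ j, (0 - η j)| * Real.exp (ε * ∑ j, 1 / |η j|)) := by
        gcongr
        · exact abs_prod_sub_le hxε ζ hζ0
        · exact abs_prod_sub_le hxε η hη0
    _ = Real.exp (ε * ((∑ j, 1 / |ζ j|) + ∑ j, 1 / |η j|)) * |p 0| := by
        rw [hp, abs_mul, abs_mul, mul_add, Real.exp_add]
        ring
    _ ≤ 2 * Real.exp (ε * ((∑ j, 1 / |ζ j|) + 1 / |(-ε)| + 1 / |ε| + ∑ j, 1 / |η j|)) *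
          |p 0| := by
        gcongr
        refine le_trans (Real.exp_le_exp.mpr ?_) (le_mul_of_one_le_left (Real.exp_nonneg _) one_le_two)
        gcongr
        have h₁ : 0 ≤ 1 / |(-ε)| := by positivity
        have h₂ : 0 ≤ 1 / |ε| := by positivity
        linarith
end

section
/- For every n ≥ 2 and every 1 ≤ j ≤ n−1, the half-gap of the sorted first n terms of the dyadic enumeration satisfies s_n(j) ≤ 2/n. -/
/-- The first `2 ^ m + 1` terms of the dyadic enumeration contain every `i / 2 ^ m` in `[0, 1]`. -/
theorem exists_le_dyadic_enumeration_eq {a : ℕ → ℝ} (ha0 : a 0 = 0) (ha1 : a 1 = 1)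
    (ha : ∀ k i : ℕ, 1 ≤ k → 1 ≤ i → i ≤ 2 ^ (k - 1) →
      a (2 ^ (k - 1) + i) = (2 * (i : ℝ) - 1) / 2 ^ k) (m : ℕ) :
    ∀ i : ℕ, i ≤ 2 ^ m → ∃ r ≤ 2 ^ m, a r = (i : ℝ) / 2 ^ m := by
  induction m with
  | zero =>
    intro i hi
    refine ⟨i, hi, ?_⟩
    have hi' : i ≤ 1 := by simpa using hi
    interval_cases i <;> simp [ha0, ha1]
  | succ m ih =>
    intro i hi
    rw [pow_succ] at hi
    obtain ⟨t, rfl | rfl⟩ := Nat.even_or_odd' i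
    · obtain ⟨r, hr, har⟩ := ih t (by omega)
      refine ⟨r, hr.trans (Nat.pow_le_pow_right two_pos m.le_succ), ?_⟩
      rw [har, pow_succ]
      push_cast
      field_simp
    · refine ⟨2 ^ m + (t + 1), by rw [pow_succ]; omega, ?_⟩
      have h := ha (m + 1) (t + 1) (by omega) (by omega) (by rw [Nat.add_sub_cancel]; omega)
      rw [Nat.add_sub_cancel] at h
      rw [h]
      push_cast
      ring

/-- All terms of the dyadic enumeration lie in `[0, 1]`. -/
theorem dyadic_enumeration_mem_Icc {a : ℕ → ℝ} (ha0 : a 0 = 0) (ha1 : a 1 = 1)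
    (ha : ∀ k i : ℕ, 1 ≤ k → 1 ≤ i → i ≤ 2 ^ (k - 1) →
      a (2 ^ (k - 1) + i) = (2 * (i : ℝ) - 1) / 2 ^ k) (r : ℕ) :
    a r ∈ Set.Icc (0 : ℝ) 1 := by
  obtain hr | hr := lt_or_ge r 2
  · interval_cases r <;> simp [ha0, ha1]
  have hlow : 2 ^ Nat.log 2 (r - 1) ≤ r - 1 := Nat.pow_log_le_self 2 (by omega)
  have hupp : r - 1 < 2 ^ (Nat.log 2 (r - 1) + 1) := Nat.lt_pow_succ_log_self one_lt_two _
  generalize Nat.log 2 (r - 1) = m at hlow hupp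
  obtain ⟨i, rfl⟩ := Nat.exists_eq_add_of_le (show 2 ^ m ≤ r by omega)
  rw [pow_succ] at hupp
  have hi1 : 1 ≤ i := by omega
  have him : i ≤ 2 ^ m := by omega
  have h := ha (m + 1) i (by omega) hi1 (by rwa [Nat.add_sub_cancel])
  rw [Nat.add_sub_cancel] at h
  have hi1' : (1 : ℝ) ≤ i := by exact_mod_cast hi1
  have him' : (i : ℝ) ≤ 2 ^ m := by exact_mod_cast him
  rw [h]
  refine ⟨div_nonneg (by linarith) (by positivity), ?_⟩
  rw [div_le_one (by positivity), pow_succ]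
  linarith


/-- For the dyadic enumeration `a₀ = 0, a₁ = 1,
a_{2^{k-1}+i} = (2i-1)/2^k` (for `k ≥ 1`, `1 ≤ i ≤ 2^{k-1}`), let
`ζ_{n1} < ⋯ < ζ_{nn}` be the first `n` terms sorted increasingly.  Then for
every `n ≥ 2` and `1 ≤ j ≤ n-1` the half-gap
`s_n(j) = (ζ_{nj} + ζ_{n(j+1)})/2 - ζ_{nj}` satisfies `s_n(j) ≤ 2/n`. -/
theorem stmt_3
    (a : ℕ → ℝ)
    (ha0 : a 0 = 0) (ha1 : a 1 = 1)
    (ha : ∀ k i : ℕ, 1 ≤ k → 1 ≤ i → i ≤ 2 ^ (k - 1) →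
      a (2 ^ (k - 1) + i) = (2 * (i : ℝ) - 1) / 2 ^ k)
    (ζ : ℕ → ℕ → ℝ)
    (hζmono : ∀ n, 2 ≤ n → ∀ j k, 1 ≤ j → j < k → k ≤ n → ζ n j < ζ n k)
    (hζimage : ∀ n, 2 ≤ n →
      (Finset.Icc 1 n).image (ζ n) = (Finset.range n).image a) :
    ∀ n, 2 ≤ n → ∀ j, 1 ≤ j → j ≤ n - 1 →
      (ζ n j + ζ n (j + 1)) / 2 - ζ n j ≤ 2 / (n : ℝ) := by
  intro n hn j hj hjn
  have hlow : 2 ^ Nat.log 2 (n - 1) ≤ n - 1 := Nat.pow_log_le_self 2 (by omega)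
  have hupp : n - 1 < 2 ^ (Nat.log 2 (n - 1) + 1) := Nat.lt_pow_succ_log_self one_lt_two _
  generalize Nat.log 2 (n - 1) = m at hlow hupp
  have hmem : ∀ l, 1 ≤ l → l ≤ n → ζ n l ∈ Set.Icc (0 : ℝ) 1 := by
    intro l hl hln
    have hl' : ζ n l ∈ (Finset.range n).image a :=
      hζimage n hn ▸ Finset.mem_image_of_mem _ (Finset.mem_Icc.2 ⟨hl, hln⟩)
    obtain ⟨r, -, hr⟩ := Finset.mem_image.1 hl'
    exact hr ▸ dyadic_enumeration_mem_Icc ha0 ha1 ha r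
  have hx := (hmem j hj (by omega)).1
  have hy := (hmem (j + 1) (by omega) (by omega)).2
  have hpos : (0 : ℝ) < 2 ^ m := by positivity
  have hgap : ζ n (j + 1) - ζ n j ≤ 1 / 2 ^ m := by
    by_contra! hlt
    have hfloor := Nat.floor_le (mul_nonneg hx hpos.le)
    have hfloor' := Nat.lt_floor_add_one (ζ n j * 2 ^ m)
    generalize ⌊ζ n j * 2 ^ m⌋₊ = q at hfloor hfloor'
    rw [div_lt_iff₀ hpos, sub_mul] at hlt
    have hq : q + 1 ≤ 2 ^ m := by
      have : ((q + 1 : ℕ) : ℝ) ≤ (2 ^ m : ℕ) := by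
        push_cast
        nlinarith
      exact_mod_cast this
    obtain ⟨r, hr, har⟩ := exists_le_dyadic_enumeration_eq ha0 ha1 ha m (q + 1) hq
    have hr' : a r ∈ (Finset.Icc 1 n).image (ζ n) :=
      hζimage n hn ▸ Finset.mem_image_of_mem _ (Finset.mem_range.2 (by omega))
    obtain ⟨l, hl, hlr⟩ := Finset.mem_image.1 hr'
    obtain ⟨hl1, hln⟩ := Finset.mem_Icc.1 hl
    have hleft : ζ n j < ζ n l := by
      rw [hlr, har, lt_div_iff₀ hpos]
      exact_mod_cast hfloor'
    have hright : ζ n l < ζ n (j + 1) := by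
      rw [hlr, har, div_lt_iff₀ hpos]
      push_cast
      linarith
    rcases lt_trichotomy l j with h | rfl | h
    · exact (hζmono n hn l j hl1 h (by omega)).not_gt hleft
    · exact lt_irrefl _ hleft
    · obtain rfl | h := (Nat.succ_le_of_lt h).eq_or_lt
      · exact lt_irrefl _ hright
      · exact (hζmono n hn (j + 1) l (by omega) h hln).not_gt hright
  have hn2 : (n : ℝ) ≤ 2 * 2 ^ m := by
    rw [pow_succ] at hupp
    have : n ≤ 2 * 2 ^ m := by omega
    exact_mod_cast this
  have hn0 : (0 : ℝ) < n := by positivity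
  have hinv : 1 / (2 : ℝ) ^ m ≤ 2 / n := by
    rw [div_le_div_iff₀ hpos hn0]
    linarith
  have hn1 : (0 : ℝ) < 2 / n := by positivity
  linarith
end

section
/- There exists a constant C > 0 such that for every n ≥ 2 and every 1 ≤ j ≤ n−1, (1/n) ∑_{k=1}^{n} 1/|m_{nj} − ζ_{nk}| ≤ C · (1 + log n) for the sorted first n terms of the dyadic enumeration; equivalently H_n(j) ≥ 1/(C(1 + log n)). -/
/-- The reciprocal distances from a midpoint of consecutive points of a `δ`-separated increasing
family are dominated by harmonic sums. -/
theorem sum_inv_abs_midpoint_sub_le {x : ℕ → ℝ} {δ : ℝ} (hδ : 0 < δ) {n j : ℕ}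
    (hx : ∀ k l, 1 ≤ k → k ≤ l → l ≤ n → δ * ((l : ℝ) - k) ≤ x l - x k)
    (hj : 1 ≤ j) (hjn : j < n) :
    ∑ k ∈ Finset.Icc 1 n, 1 / |(x j + x (j + 1)) / 2 - x k| ≤
      4 / δ * (1 + Real.log n) := by
  obtain ⟨l, rfl⟩ := Nat.exists_eq_add_of_lt hjn
  have hgap := hx j (j + 1) hj (by omega) (by omega)
  push_cast at hgap
  have harm : ∀ m : ℕ, m ≤ j + l + 1 →
      ∑ i ∈ Finset.range m, 2 / δ * (1 / ((i : ℝ) + 1)) ≤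
        2 / δ * (1 + Real.log ((j + l + 1 : ℕ) : ℝ)) := by
    intro m hm
    rw [← Finset.mul_sum]
    refine mul_le_mul_of_nonneg_left ?_ (by positivity)
    have hmono : ∑ i ∈ Finset.range m, 1 / ((i : ℝ) + 1) ≤
        ∑ i ∈ Finset.range (j + l + 1), 1 / ((i : ℝ) + 1) :=
      Finset.sum_le_sum_of_subset_of_nonneg (Finset.range_mono hm)
        fun i _ _ => by positivity
    have hlog := harmonic_le_one_add_log (j + l + 1)
    simp only [harmonic, ← one_div] at hlog
    push_cast at hlog ⊢
    exact hmono.trans hlog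
  have inv_le : ∀ (i : ℕ) (y : ℝ), δ * (i + 1) / 2 ≤ |y| →
      1 / |y| ≤ 2 / δ * (1 / ((i : ℝ) + 1)) := by
    intro i y hy
    have hpos : 0 < δ * (i + 1) / 2 := by positivity
    calc 1 / |y| ≤ 1 / (δ * (i + 1) / 2) := one_div_le_one_div_of_le hpos hy
      _ = 2 / δ * (1 / ((i : ℝ) + 1)) := by field_simp
  have hrange : ∑ k ∈ Finset.Icc 1 (j + l + 1), 1 / |(x j + x (j + 1)) / 2 - x k| =
      ∑ k ∈ Finset.range (j + (l + 1)), 1 / |(x j + x (j + 1)) / 2 - x (k + 1)| := by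
    rw [Finset.range_eq_Ico, Finset.sum_Ico_add' (fun k => 1 / |(x j + x (j + 1)) / 2 - x k|)]
    rfl
  have hleft : ∑ k ∈ Finset.range j, 1 / |(x j + x (j + 1)) / 2 - x (k + 1)| ≤
      ∑ i ∈ Finset.range j, 2 / δ * (1 / ((i : ℝ) + 1)) := by
    rw [← Finset.sum_range_reflect]
    refine Finset.sum_le_sum fun i hi => inv_le i _ (le_trans ?_ (le_abs_self _))
    rw [Finset.mem_range] at hi
    have h := hx (j - 1 - i + 1) j (by omega) (by omega) (by omega)
    have hcast : ((j - 1 - i + 1 : ℕ) : ℝ) = j - i := by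
      rw [show j - 1 - i + 1 = j - i by omega, Nat.cast_sub hi.le]
    rw [hcast] at h
    nlinarith [mul_nonneg hδ.le (Nat.cast_nonneg (α := ℝ) i)]
  have hright : ∑ k ∈ Finset.range (l + 1), 1 / |(x j + x (j + 1)) / 2 - x (j + k + 1)| ≤
      ∑ i ∈ Finset.range (l + 1), 2 / δ * (1 / ((i : ℝ) + 1)) := by
    refine Finset.sum_le_sum fun i hi => inv_le i _ (le_trans ?_ (neg_le_abs _))
    rw [Finset.mem_range] at hi
    have h := hx (j + 1) (j + i + 1) (by omega) (by omega) (by omega)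
    push_cast at h
    nlinarith [mul_nonneg hδ.le (Nat.cast_nonneg (α := ℝ) i)]
  rw [hrange, Finset.sum_range_add]
  calc _ ≤ 2 / δ * (1 + Real.log ((j + l + 1 : ℕ) : ℝ)) +
        2 / δ * (1 + Real.log ((j + l + 1 : ℕ) : ℝ)) :=
        add_le_add (hleft.trans (harm j (by omega))) (hright.trans (harm (l + 1) (by omega)))
    _ = 4 / δ * (1 + Real.log ((j + l + 1 : ℕ) : ℝ)) := by ring

/-- The first `n` terms of the dyadic enumeration are integer multiples of
`2 ^ (-(log₂ n + 1))`. -/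
theorem exists_int_eq_dyadic_mul_two_pow {a : ℕ → ℝ} (ha0 : a 0 = 0) (ha1 : a 1 = 1)
    (ha : ∀ k i : ℕ, 1 ≤ k → 1 ≤ i → i ≤ 2 ^ (k - 1) →
      a (2 ^ (k - 1) + i) = (2 * (i : ℝ) - 1) / 2 ^ k)
    {n m : ℕ} (hm : m < n) : ∃ z : ℤ, a m * 2 ^ (Nat.log 2 n + 1) = z := by
  rcases Nat.lt_or_ge m 2 with h | h
  · interval_cases m
    · exact ⟨0, by simp [ha0]⟩
    · exact ⟨2 ^ (Nat.log 2 n + 1), by simp [ha1]⟩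
  · set p := Nat.log 2 (m - 1)
    have hlow : 2 ^ p ≤ m - 1 := Nat.pow_log_le_self 2 (by omega)
    have hupp : m - 1 < 2 ^ (p + 1) := Nat.lt_pow_succ_log_self (by norm_num) _
    rw [pow_succ] at hupp
    have hp : p ≤ Nat.log 2 n := Nat.log_mono_right (by omega)
    have hval := ha (p + 1) (m - 2 ^ p) (by omega) (by omega)
      (by rw [Nat.add_sub_cancel]; omega)
    rw [Nat.add_sub_cancel, Nat.add_sub_cancel' (by omega)] at hval
    obtain ⟨q, hq⟩ := Nat.exists_eq_add_of_le hp
    refine ⟨(2 * ((m - 2 ^ p : ℕ) : ℤ) - 1) * 2 ^ q, ?_⟩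
    rw [hval, hq, show p + q + 1 = (p + 1) + q by ring, pow_add _ (p + 1) q]
    push_cast
    field_simp

/-- For the dyadic enumeration (sorted first `n` terms
`ζ_{n1} < ⋯ < ζ_{nn}`, midpoints `m_{nj} = (ζ_{nj}+ζ_{n(j+1)})/2`), there is a
constant `C > 0` such that for every `n ≥ 2` and `1 ≤ j ≤ n-1`,
`(1/n) ∑_{k=1}^n 1/|m_{nj} - ζ_{nk}| ≤ C (1 + log n)`; equivalently
`H_n(j) ≥ 1/(C(1 + log n))`. -/
theorem stmt_4
    (a : ℕ → ℝ)
    (ha0 : a 0 = 0) (ha1 : a 1 = 1)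
    (ha : ∀ k i : ℕ, 1 ≤ k → 1 ≤ i → i ≤ 2 ^ (k - 1) →
      a (2 ^ (k - 1) + i) = (2 * (i : ℝ) - 1) / 2 ^ k)
    (ζ : ℕ → ℕ → ℝ)
    (hζmono : ∀ n, 2 ≤ n → ∀ j k, 1 ≤ j → j < k → k ≤ n → ζ n j < ζ n k)
    (hζimage : ∀ n, 2 ≤ n →
      (Finset.Icc 1 n).image (ζ n) = (Finset.range n).image a) :
    ∃ C : ℝ, 0 < C ∧ ∀ n : ℕ, 2 ≤ n → ∀ j, 1 ≤ j → j ≤ n - 1 →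
      (1 / (n : ℝ)) * ∑ k ∈ Finset.Icc 1 n,
          1 / |(ζ n j + ζ n (j + 1)) / 2 - ζ n k| ≤
        C * (1 + Real.log n) := by
  refine ⟨8, by norm_num, fun n hn j hj hjn => ?_⟩
  set D : ℝ := 2 ^ (Nat.log 2 n + 1) with hD
  have hD0 : 0 < D := by positivity
  have hn0 : (0 : ℝ) < n := by positivity
  have hDn : D ≤ 2 * n := by
    have h : 2 ^ Nat.log 2 n ≤ n := Nat.pow_log_le_self 2 (by omega)
    have h' : (2 : ℝ) ^ Nat.log 2 n ≤ n := by exact_mod_cast h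
    rw [hD, pow_succ]
    linarith
  have hint : ∀ k, 1 ≤ k → k ≤ n → ∃ z : ℤ, ζ n k * D = z := by
    intro k hk hkn
    have hmem : ζ n k ∈ (Finset.range n).image a := by
      rw [← hζimage n hn]
      exact Finset.mem_image_of_mem _ (Finset.mem_Icc.2 ⟨hk, hkn⟩)
    obtain ⟨m, hm, hmk⟩ := Finset.mem_image.1 hmem
    rw [← hmk]
    exact exists_int_eq_dyadic_mul_two_pow ha0 ha1 ha (Finset.mem_range.1 hm)
  have hsep : ∀ k l, 1 ≤ k → k ≤ l → l ≤ n → 1 / D * ((l : ℝ) - k) ≤ ζ n l - ζ n k := by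
    intro k l hk hkl
    induction l, hkl using Nat.le_induction with
    | base => simp
    | succ l hkl ih =>
      intro hl
      have hprev := ih (by omega)
      obtain ⟨z, hz⟩ := hint l (by omega) (by omega)
      obtain ⟨w, hw⟩ := hint (l + 1) (by omega) hl
      have hlt := mul_lt_mul_of_pos_right
        (hζmono n hn l (l + 1) (by omega) (by omega) hl) hD0
      rw [hz, hw, Int.cast_lt] at hlt
      have hzw : (z : ℝ) + 1 ≤ w := by exact_mod_cast hlt
      have hstep : 1 / D ≤ ζ n (l + 1) - ζ n l := by
        rw [div_le_iff₀ hD0]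
        linarith
      push_cast
      linarith
  have hsum := sum_inv_abs_midpoint_sub_le (one_div_pos.2 hD0) hsep hj (by omega)
  have hlog : 0 ≤ Real.log n := Real.log_natCast_nonneg n
  rw [div_mul_eq_mul_div, one_mul, div_le_iff₀ hn0]
  calc _ ≤ 4 / (1 / D) * (1 + Real.log n) := hsum
    _ = 4 * D * (1 + Real.log n) := by field_simp
    _ ≤ 4 * (2 * n) * (1 + Real.log n) := by gcongr
    _ = 8 * (1 + Real.log n) * n := by ring
end

section
/- The dyadic enumeration sequence has Property (★): max_{1≤j≤n−1} s_n(j)/H_n(j) → 0 as n → ∞. -/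
open Filter

section DyadicEnumeration

variable {a : ℕ → ℝ}

/-- The first `2 ^ p + 1` terms of the dyadic enumeration are multiples of `2⁻ᵖ` in `[0, 1]`. -/
lemma exists_eq_div_two_pow_of_le (ha0 : a 0 = 0) (ha1 : a 1 = 1)
    (ha : ∀ k i : ℕ, 1 ≤ k → 1 ≤ i → i ≤ 2 ^ (k - 1) →
      a (2 ^ (k - 1) + i) = (2 * (i : ℝ) - 1) / 2 ^ k)
    (p : ℕ) : ∀ i ≤ 2 ^ p, ∃ z : ℕ, z ≤ 2 ^ p ∧ a i = z / 2 ^ p := by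
  induction p with
  | zero =>
    intro i hi
    have hi' : i = 0 ∨ i = 1 := by simp at hi; omega
    rcases hi' with rfl | rfl
    · exact ⟨0, by simp [ha0]⟩
    · exact ⟨1, by simp [ha1]⟩
  | succ p ih =>
    intro i hi
    have hp : 2 ^ (p + 1) = 2 * 2 ^ p := pow_succ' 2 p
    by_cases h : i ≤ 2 ^ p
    · obtain ⟨z, hz, hz'⟩ := ih i h
      refine ⟨2 * z, by omega, ?_⟩
      rw [hz']
      push_cast
      field_simp
      ring
    · obtain ⟨l, rfl⟩ := Nat.exists_eq_add_of_le (le_of_not_ge h)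
      refine ⟨2 * l - 1, by omega, ?_⟩
      have hl := ha (p + 1) l (by omega) (by omega) (by rw [Nat.add_sub_cancel]; omega)
      rw [Nat.add_sub_cancel] at hl
      rw [hl, Nat.cast_sub (by omega)]
      push_cast
      rfl

/-- Every multiple of `2⁻ᵖ` in `[0, 1]` is one of the first `2 ^ p + 1` terms of the dyadic
enumeration. -/
lemma exists_le_and_eq_div_two_pow (ha0 : a 0 = 0) (ha1 : a 1 = 1)
    (ha : ∀ k i : ℕ, 1 ≤ k → 1 ≤ i → i ≤ 2 ^ (k - 1) →
      a (2 ^ (k - 1) + i) = (2 * (i : ℝ) - 1) / 2 ^ k)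
    (p : ℕ) : ∀ c : ℕ, c ≤ 2 ^ p → ∃ i ≤ 2 ^ p, a i = c / 2 ^ p := by
  induction p with
  | zero =>
    intro c hc
    have hc' : c = 0 ∨ c = 1 := by simp at hc; omega
    rcases hc' with rfl | rfl
    · exact ⟨0, by simp [ha0]⟩
    · exact ⟨1, by simp [ha1]⟩
  | succ p ih =>
    intro c hc
    have hp : 2 ^ (p + 1) = 2 * 2 ^ p := pow_succ' 2 p
    obtain ⟨l, rfl | rfl⟩ := Nat.even_or_odd' c
    · obtain ⟨i, hi, hi'⟩ := ih l (by omega)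
      refine ⟨i, by omega, ?_⟩
      rw [hi']
      push_cast
      field_simp
      ring
    · have hl := ha (p + 1) (l + 1) (by omega) (by omega) (by rw [Nat.add_sub_cancel]; omega)
      rw [Nat.add_sub_cancel] at hl
      refine ⟨2 ^ p + (l + 1), by omega, ?_⟩
      rw [hl]
      push_cast
      ring

end DyadicEnumeration

/-- If consecutive points are at least `δ` apart and the `j`-th gap is at most `2 * δ`, then the
sum of the ratios of the `j`-th half-gap to the distances from the `j`-th midpoint is at most four
times a harmonic number. -/
lemma sum_halfGap_div_abs_midpoint_sub_le {x : ℕ → ℝ} {n j : ℕ} {δ : ℝ} (hδ : 0 < δ)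
    (hsep : ∀ k l, 1 ≤ k → k ≤ l → l ≤ n → δ * ((l : ℝ) - k) ≤ x l - x k)
    (hj : 1 ≤ j) (hjn : j + 1 ≤ n) (hgap : x (j + 1) - x j ≤ 2 * δ) :
    ((x j + x (j + 1)) / 2 - x j) * ∑ k ∈ Finset.Icc 1 n, 1 / |(x j + x (j + 1)) / 2 - x k| ≤
      4 * ∑ i ∈ Finset.range n, 1 / ((i : ℝ) + 1) := by
  set m := (x j + x (j + 1)) / 2 with hm
  have hstep : δ ≤ x (j + 1) - x j := by
    have := hsep j (j + 1) hj (by omega) hjn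
    push_cast at this
    linarith
  have key : ∀ (k i : ℕ), δ * ((i : ℝ) + 1) / 2 ≤ |m - x k| →
      (m - x j) * (1 / |m - x k|) ≤ 2 * (1 / ((i : ℝ) + 1)) := by
    intro k i h
    have hi : (0 : ℝ) < (i : ℝ) + 1 := by positivity
    have hpos : 0 < |m - x k| := lt_of_lt_of_le (by positivity) h
    rw [mul_one_div, mul_one_div, div_le_div_iff₀ hpos hi]
    have : m - x j ≤ δ := by linarith
    nlinarith
  rw [Finset.mul_sum, ← Finset.sum_filter_add_sum_filter_not _ (fun k => k ≤ j)]
  have bound : ∀ (s : Finset ℕ) (g : ℕ → ℕ), Set.InjOn g s → (∀ k ∈ s, g k < n) →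
      (∀ k ∈ s, δ * ((g k : ℝ) + 1) / 2 ≤ |m - x k|) →
      ∑ k ∈ s, (m - x j) * (1 / |m - x k|) ≤
        2 * ∑ i ∈ Finset.range n, 1 / ((i : ℝ) + 1) := by
    intro s g hinj hlt hle
    calc ∑ k ∈ s, (m - x j) * (1 / |m - x k|)
        ≤ ∑ k ∈ s, 2 * (1 / ((g k : ℝ) + 1)) :=
          Finset.sum_le_sum fun k hk => key k (g k) (hle k hk)
      _ = ∑ i ∈ s.image g, 2 * (1 / ((i : ℝ) + 1)) := (Finset.sum_image
          (f := fun i : ℕ => 2 * (1 / ((i : ℝ) + 1))) hinj).symm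
      _ ≤ ∑ i ∈ Finset.range n, 2 * (1 / ((i : ℝ) + 1)) := by
          refine Finset.sum_le_sum_of_subset_of_nonneg ?_ fun i _ _ => by positivity
          exact Finset.image_subset_iff.2 fun k hk => Finset.mem_range.2 (hlt k hk)
      _ = _ := by rw [Finset.mul_sum]
  have h1 := bound ((Finset.Icc 1 n).filter fun k => k ≤ j) (fun k => j - k)
    (by intro k hk l hl h; simp at hk hl h; omega)
    (by intro k hk; simp at hk ⊢; omega)
    (by
      intro k hk
      simp only [Finset.mem_filter, Finset.mem_Icc] at hk
      have := hsep k j hk.1.1 hk.2 (by omega)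
      have hkj : (k : ℝ) ≤ j := by exact_mod_cast hk.2
      refine le_trans ?_ (le_abs_self _)
      rw [Nat.cast_sub hk.2]
      nlinarith)
  have h2 := bound ((Finset.Icc 1 n).filter fun k => ¬ k ≤ j) (fun k => k - (j + 1))
    (by intro k hk l hl h; simp at hk hl h; omega)
    (by intro k hk; simp at hk ⊢; omega)
    (by
      intro k hk
      simp only [Finset.mem_filter, Finset.mem_Icc] at hk
      have hjk : j + 1 ≤ k := by omega
      have := hsep (j + 1) k (by omega) hjk (by omega)
      have hkj : ((j + 1 : ℕ) : ℝ) ≤ k := by exact_mod_cast hjk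
      refine le_trans ?_ (neg_le_abs _)
      rw [Nat.cast_sub hjk]
      nlinarith)
  linarith

/-- The dyadic enumeration has Property (★):
`max_{1 ≤ j ≤ n-1} s_n(j)/H_n(j) → 0` as `n → ∞`, where, for the sorted first
`n` terms `ζ_{n1} < ⋯ < ζ_{nn}`, `m_{nj} = (ζ_{nj}+ζ_{n(j+1)})/2`,
`s_n(j) = m_{nj} - ζ_{nj}` and
`H_n(j) = ((1/n) ∑_{k=1}^n 1/|m_{nj} - ζ_{nk}|)⁻¹`. -/
theorem stmt_5
    (a : ℕ → ℝ)
    (ha0 : a 0 = 0) (ha1 : a 1 = 1)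
    (ha : ∀ k i : ℕ, 1 ≤ k → 1 ≤ i → i ≤ 2 ^ (k - 1) →
      a (2 ^ (k - 1) + i) = (2 * (i : ℝ) - 1) / 2 ^ k)
    (ζ : ℕ → ℕ → ℝ)
    (hζmono : ∀ n, 2 ≤ n → ∀ j k, 1 ≤ j → j < k → k ≤ n → ζ n j < ζ n k)
    (hζimage : ∀ n, 2 ≤ n →
      (Finset.Icc 1 n).image (ζ n) = (Finset.range n).image a) :
    Tendsto (fun n : ℕ => ⨆ j ∈ Finset.Icc 1 (n - 1),
        ((ζ n j + ζ n (j + 1)) / 2 - ζ n j) /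
          ((1 / (n : ℝ)) * ∑ k ∈ Finset.Icc 1 n,
              1 / |(ζ n j + ζ n (j + 1)) / 2 - ζ n k|)⁻¹)
      atTop (nhds 0) := by
  have hlim : Tendsto (fun n : ℕ => 4 * ((n : ℝ)⁻¹ * ∑ i ∈ Finset.range n, 1 / ((i : ℝ) + 1)))
      atTop (nhds 0) := by
    simpa using (tendsto_one_div_add_atTop_nhds_zero_nat (𝕜 := ℝ)).cesaro.const_mul 4
  refine tendsto_of_tendsto_of_tendsto_of_le_of_le' tendsto_const_nhds hlim ?_ ?_
  · filter_upwards [eventually_ge_atTop 2] with n hn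
    refine Real.iSup_nonneg fun j => Real.iSup_nonneg fun hj => ?_
    rw [Finset.mem_Icc] at hj
    have := hζmono n hn j (j + 1) hj.1 (by omega) (by omega)
    exact div_nonneg (by linarith) (by positivity)
  · filter_upwards [eventually_ge_atTop 2] with n hn
    refine Real.iSup_le (fun j => Real.iSup_le (fun hj => ?_) (by positivity)) (by positivity)
    rw [Finset.mem_Icc] at hj
    obtain ⟨hj1, hjn⟩ := hj
    obtain ⟨p, hp, hp'⟩ : ∃ p, 2 ^ p < n ∧ n ≤ 2 ^ (p + 1) := by
      have h1 := Nat.pow_log_le_self 2 (x := n - 1) (by omega)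
      have h2 := Nat.lt_pow_succ_log_self (b := 2) (by omega) (n - 1)
      exact ⟨Nat.log 2 (n - 1), by omega, by simp only [Nat.succ_eq_add_one] at h2; omega⟩
    have hgrid : ∀ k, 1 ≤ k → k ≤ n →
        ∃ z : ℕ, z ≤ 2 ^ (p + 1) ∧ ζ n k = z / 2 ^ (p + 1) := by
      intro k hk hkn
      have hmem : ζ n k ∈ (Finset.range n).image a :=
        hζimage n hn ▸ Finset.mem_image_of_mem _ (Finset.mem_Icc.2 ⟨hk, hkn⟩)
      obtain ⟨i, hi, hik⟩ := Finset.mem_image.1 hmem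
      rw [← hik]
      exact exists_eq_div_two_pow_of_le ha0 ha1 ha (p + 1) i
        ((Finset.mem_range.1 hi).le.trans hp')
    have hstep : ∀ k, 1 ≤ k → k + 1 ≤ n → 1 / 2 ^ (p + 1) ≤ ζ n (k + 1) - ζ n k := by
      intro k hk hkn
      obtain ⟨z, -, hz⟩ := hgrid k hk (by omega)
      obtain ⟨w, -, hw⟩ := hgrid (k + 1) (by omega) hkn
      have hlt := hζmono n hn k (k + 1) hk (by omega) hkn
      rw [hz, hw, div_lt_div_iff_of_pos_right (by positivity), Nat.cast_lt] at hlt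
      have hle : (z : ℝ) + 1 ≤ w := by exact_mod_cast hlt
      rw [hz, hw, ← sub_div]
      gcongr
      linarith
    have hsep : ∀ k l, 1 ≤ k → k ≤ l → l ≤ n →
        1 / 2 ^ (p + 1) * ((l : ℝ) - k) ≤ ζ n l - ζ n k := by
      intro k l hk hkl
      induction l, hkl using Nat.le_induction with
      | base => simp
      | succ l hkl ih =>
        intro hl
        have h1 := ih (by omega)
        have h2 := hstep l (by omega) hl
        push_cast
        linarith
    have hgap : ζ n (j + 1) - ζ n j ≤ 2 * (1 / 2 ^ (p + 1)) := by
      have hδ : (2 : ℝ) * (1 / 2 ^ (p + 1)) = 1 / 2 ^ p := by field_simp; ring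
      rw [hδ]
      by_contra! hlt
      have hP : (0 : ℝ) < 2 ^ p := by positivity
      obtain ⟨z, -, hz⟩ := hgrid j hj1 (by omega)
      obtain ⟨w, hw, hw'⟩ := hgrid (j + 1) (by omega) (by omega)
      have hx0 : 0 ≤ ζ n j := by rw [hz]; positivity
      have hy1 : ζ n (j + 1) ≤ 1 := by
        rw [hw', div_le_one (by positivity)]
        exact_mod_cast hw
      have hf1 := Nat.lt_floor_add_one (ζ n j * 2 ^ p)
      have hf2 := Nat.floor_le (a := ζ n j * 2 ^ p) (by positivity)
      set c := ⌊ζ n j * 2 ^ p⌋₊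
      have hxc : ζ n j < ((c + 1 : ℕ) : ℝ) / 2 ^ p := by
        rw [lt_div_iff₀ hP]
        exact_mod_cast hf1
      have hcy : ((c + 1 : ℕ) : ℝ) / 2 ^ p < ζ n (j + 1) := by
        have : (c : ℝ) / 2 ^ p ≤ ζ n j := by rwa [div_le_iff₀ hP]
        push_cast
        rw [add_div]
        linarith
      have hcP : c + 1 ≤ 2 ^ p := by
        have := (hcy.trans_le hy1).le
        rw [div_le_one hP] at this
        exact_mod_cast this
      obtain ⟨i, hi, hia⟩ := exists_le_and_eq_div_two_pow ha0 ha1 ha p (c + 1) hcP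
      have hmem : a i ∈ (Finset.Icc 1 n).image (ζ n) :=
        hζimage n hn ▸ Finset.mem_image_of_mem _ (Finset.mem_range.2 (by omega))
      obtain ⟨k, hk, hki⟩ := Finset.mem_image.1 hmem
      rw [Finset.mem_Icc] at hk
      rw [← hia, ← hki] at hxc hcy
      rcases Nat.lt_or_ge j k with h | h
      · rcases (Nat.succ_le_of_lt h).eq_or_lt with h' | h'
        · exact absurd hcy (by rw [← h']; exact lt_irrefl _)
        · exact lt_asymm hcy (hζmono n hn (j + 1) k (by omega) h' hk.2)
      · rcases h.eq_or_lt with h' | h'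
        · exact absurd hxc (by rw [h']; exact lt_irrefl _)
        · exact lt_asymm hxc (hζmono n hn k j hk.1 h' (by omega))
    have hmain := sum_halfGap_div_abs_midpoint_sub_le (by positivity) hsep hj1 (by omega) hgap
    calc _ = (n : ℝ)⁻¹ * (((ζ n j + ζ n (j + 1)) / 2 - ζ n j) * ∑ k ∈ Finset.Icc 1 n,
              1 / |(ζ n j + ζ n (j + 1)) / 2 - ζ n k|) := by
          rw [div_inv_eq_mul]; ring
      _ ≤ (n : ℝ)⁻¹ * (4 * ∑ i ∈ Finset.range n, 1 / ((i : ℝ) + 1)) := by gcongr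
      _ = _ := by ring
end

section
/- Let (b_{nj})_{j=1,…,n; n=1,2,…} be a triangular array of points in [0,1] with each row strictly increasing in j. Suppose there exist positive constants α₁, α₂, B₁, B₂ with 0 < α₂ ≤ α₁ < 1 + α₂, and an n₀ ∈ ℕ, such that for every integer n ≥ n₀ and all j, k ∈ {1, …, n}: B₁ · |(j−k)/n|^{α₁} ≤ |b_{nj} − b_{nk}| ≤ B₂ · |(j−k)/n|^{α₂}. Then the array has Property (★). -/
open Filter

/-- Midpoint of adjacent points in row `n` of a triangular array (rows indexed
`j = 1, …, n`): `m_{nj} = (b_{nj} + b_{n(j+1)})/2`. -/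
noncomputable def mid (b : ℕ → ℕ → ℝ) (n j : ℕ) : ℝ := (b n j + b n (j + 1)) / 2

/-- Half-gap `s_n(j) = m_{nj} - b_{nj}`. -/
noncomputable def sgap (b : ℕ → ℕ → ℝ) (n j : ℕ) : ℝ := mid b n j - b n j

/-- `H_n(j) = ((1/n) ∑_{k=1}^n 1/|m_{nj} - b_{nk}|)⁻¹`. -/
noncomputable def Hfun (b : ℕ → ℕ → ℝ) (n j : ℕ) : ℝ :=
  ((1 / (n : ℝ)) * ∑ k ∈ Finset.Icc 1 n, 1 / |mid b n j - b n k|)⁻¹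

/-- Property (★): `max_{1 ≤ j ≤ n-1} s_n(j)/H_n(j) → 0` as `n → ∞`. -/
def PropertyStar (b : ℕ → ℕ → ℝ) : Prop :=
  Tendsto (fun n : ℕ => ⨆ j ∈ Finset.Icc 1 (n - 1), sgap b n j / Hfun b n j)
    atTop (nhds 0)

/-- The midpoint of the `j`-th gap is at least half as far from `b n k` as `b n j` is. -/
theorem half_dist_le_dist_mid (b : ℕ → ℕ → ℝ) (n j k : ℕ)
    (hgap : b n j < b n (j + 1)) (hle : k ≤ j → b n k ≤ b n j)
    (hlt : j < k → b n (j + 1) ≤ b n k) :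
    |b n j - b n k| / 2 ≤ |mid b n j - b n k| := by
  unfold mid
  rcases le_or_gt k j with h | h
  · have := hle h
    rw [abs_of_nonneg (by linarith), abs_of_nonneg (by linarith)]
    linarith
  · have := hlt h
    rw [abs_of_nonpos (by linarith), abs_of_nonpos (by linarith)]
    linarith

/-- Row-wise bound on `s_n(j) / H_n(j)` for an exponent `β > 1`. -/
theorem sgap_div_Hfun_le (b : ℕ → ℕ → ℝ) (n j : ℕ) (α β B₁ B₂ : ℝ)
    (hj : 1 ≤ j) (hjn : j < n) (hβ : 1 < β) (hB₁ : 0 < B₁)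
    (hmono : ∀ j k, 1 ≤ j → j < k → k ≤ n → b n j < b n k)
    (hlower : ∀ k, 1 ≤ k → k ≤ n →
      B₁ * |((j : ℝ) - (k : ℝ)) / (n : ℝ)| ^ β ≤ |b n j - b n k|)
    (hupper : b n (j + 1) - b n j ≤ B₂ * (n : ℝ) ^ (-α)) :
    sgap b n j / Hfun b n j ≤
      1 / (n : ℝ) + B₂ / B₁ * (∑' z : ℤ, |(z : ℝ)| ^ (-β)) * (n : ℝ) ^ (-(1 + α - β)) := by
  have hn : (0 : ℝ) < n := by exact_mod_cast (by omega : 0 < n)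
  have hgap : b n j < b n (j + 1) := hmono j (j + 1) hj (by omega) (by omega)
  have hs : sgap b n j = (b n (j + 1) - b n j) / 2 := by unfold sgap mid; ring
  have hs0 : 0 < sgap b n j := by rw [hs]; linarith
  have hterm : ∀ k ∈ Finset.Icc 1 n, 1 / |mid b n j - b n k| ≤
      (if k = j then 1 / sgap b n j else 0) +
        2 / B₁ * (n : ℝ) ^ β * |(((j : ℤ) - (k : ℤ) : ℤ) : ℝ)| ^ (-β) := by
    intro k hk
    obtain ⟨hk1, hkn⟩ := Finset.mem_Icc.1 hk
    split_ifs with hkj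
    · subst hkj
      have h : |mid b n k - b n k| = sgap b n k := abs_of_pos hs0
      rw [h]
      exact le_add_of_nonneg_right (by positivity)
    · have hz : 0 < |(j : ℝ) - (k : ℝ)| :=
        abs_pos.2 (sub_ne_zero.2 fun h => hkj (by exact_mod_cast h.symm))
      have hhalf := half_dist_le_dist_mid b n j k hgap
        (fun h => by
          rcases h.eq_or_lt with rfl | h
          · exact le_rfl
          · exact (hmono k j hk1 h hjn.le).le)
        (fun h => by
          rcases (Nat.succ_le_of_lt h).eq_or_lt with h | h
          · exact (congrArg (b n) h).le
          · exact (hmono (j + 1) k (by omega) h hkn).le)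
      have hlow := hlower k hk1 hkn
      rw [abs_div, abs_of_pos hn, Real.div_rpow hz.le hn.le] at hlow
      have hpos : 0 < B₁ * (|(j : ℝ) - (k : ℝ)| ^ β / (n : ℝ) ^ β) / 2 := by positivity
      calc 1 / |mid b n j - b n k|
          ≤ 1 / (B₁ * (|(j : ℝ) - (k : ℝ)| ^ β / (n : ℝ) ^ β) / 2) :=
            one_div_le_one_div_of_le hpos (by linarith)
        _ = 0 + 2 / B₁ * (n : ℝ) ^ β * |(((j : ℤ) - (k : ℤ) : ℤ) : ℝ)| ^ (-β) := by
            push_cast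
            rw [Real.rpow_neg hz.le]
            have := (Real.rpow_pos_of_pos hz β).ne'
            have := (Real.rpow_pos_of_pos hn β).ne'
            field_simp
            ring
  have hsum : ∑ k ∈ Finset.Icc 1 n, |(((j : ℤ) - (k : ℤ) : ℤ) : ℝ)| ^ (-β) ≤
      ∑' z : ℤ, |(z : ℝ)| ^ (-β) := by
    have hinj : Set.InjOn (fun k : ℕ => (j : ℤ) - (k : ℤ)) (Finset.Icc 1 n) :=
      fun x _ y _ h => by simpa using h
    rw [← Finset.sum_image (f := fun z : ℤ => |(z : ℝ)| ^ (-β)) hinj]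
    exact (Real.summable_abs_int_rpow hβ).sum_le_tsum _ fun _ _ => by positivity
  have hC : 0 ≤ ∑' z : ℤ, |(z : ℝ)| ^ (-β) := tsum_nonneg fun _ => by positivity
  set C := ∑' z : ℤ, |(z : ℝ)| ^ (-β)
  have htotal : ∑ k ∈ Finset.Icc 1 n, 1 / |mid b n j - b n k| ≤
      1 / sgap b n j + 2 / B₁ * (n : ℝ) ^ β * C := by
    refine (Finset.sum_le_sum hterm).trans ?_
    rw [Finset.sum_add_distrib, Finset.sum_ite_eq', if_pos (Finset.mem_Icc.2 ⟨hj, hjn.le⟩),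
      ← Finset.mul_sum]
    gcongr
  have hpow : (n : ℝ) ^ (-(1 + α - β)) = 1 / (n : ℝ) * (n : ℝ) ^ (-α) * (n : ℝ) ^ β := by
    rw [one_div, ← Real.rpow_neg_one, ← Real.rpow_add hn, ← Real.rpow_add hn]
    congr 1
    ring
  rw [Hfun, div_inv_eq_mul]
  calc sgap b n j * (1 / (n : ℝ) * ∑ k ∈ Finset.Icc 1 n, 1 / |mid b n j - b n k|)
      ≤ sgap b n j * (1 / (n : ℝ) * (1 / sgap b n j + 2 / B₁ * (n : ℝ) ^ β * C)) := by gcongr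
    _ = 1 / (n : ℝ) + sgap b n j * (1 / (n : ℝ) * (2 / B₁ * (n : ℝ) ^ β * C)) := by
        field_simp
    _ ≤ 1 / (n : ℝ) +
          B₂ * (n : ℝ) ^ (-α) / 2 * (1 / (n : ℝ) * (2 / B₁ * (n : ℝ) ^ β * C)) := by
        rw [hs]
        gcongr
    _ = 1 / (n : ℝ) + B₂ / B₁ * C * (n : ℝ) ^ (-(1 + α - β)) := by
        rw [hpow]
        field_simp

/-- Theorem 6.  A triangular array of points of `[0,1]`
with strictly increasing rows satisfying
`B₁|(j-k)/n|^{α₁} ≤ |b_{nj} - b_{nk}| ≤ B₂|(j-k)/n|^{α₂}` for all `n ≥ n₀` and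
`j, k ∈ {1, …, n}`, where `0 < α₂ ≤ α₁ < 1 + α₂` and `B₁, B₂ > 0`, has
Property (★). -/
theorem stmt_6
    (b : ℕ → ℕ → ℝ)
    (hmem : ∀ n, 1 ≤ n → ∀ j, 1 ≤ j → j ≤ n → b n j ∈ Set.Icc (0 : ℝ) 1)
    (hmono : ∀ n, 1 ≤ n → ∀ j k, 1 ≤ j → j < k → k ≤ n → b n j < b n k)
    (α₁ α₂ B₁ B₂ : ℝ) (n₀ : ℕ)
    (hα₂pos : 0 < α₂) (hα₂₁ : α₂ ≤ α₁) (hα₁ : α₁ < 1 + α₂)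
    (hB₁ : 0 < B₁) (hB₂ : 0 < B₂)
    (hbound : ∀ n, n₀ ≤ n → ∀ j, 1 ≤ j → j ≤ n → ∀ k, 1 ≤ k → k ≤ n →
      B₁ * |((j : ℝ) - (k : ℝ)) / (n : ℝ)| ^ α₁ ≤ |b n j - b n k| ∧
        |b n j - b n k| ≤ B₂ * |((j : ℝ) - (k : ℝ)) / (n : ℝ)| ^ α₂) :
    PropertyStar b := by
  obtain ⟨β, hβ₁, hβ, hβ₂⟩ : ∃ β : ℝ, 1 < β ∧ α₁ ≤ β ∧ β < 1 + α₂ :=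
    ⟨max α₁ (1 + α₂ / 2), lt_max_of_lt_right (by linarith), le_max_left _ _,
      max_lt hα₁ (by linarith)⟩
  have hlim : Tendsto (fun n : ℕ => 1 / (n : ℝ) +
      B₂ / B₁ * (∑' z : ℤ, |(z : ℝ)| ^ (-β)) * (n : ℝ) ^ (-(1 + α₂ - β))) atTop (nhds 0) := by
    have hrpow := ((tendsto_rpow_neg_atTop (sub_pos.2 hβ₂)).comp
      tendsto_natCast_atTop_atTop).const_mul (B₂ / B₁ * ∑' z : ℤ, |(z : ℝ)| ^ (-β))
    simpa using tendsto_one_div_atTop_nhds_zero_nat.add hrpow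
  refine squeeze_zero' (Eventually.of_forall fun n => ?_) ?_ hlim
  · refine Real.iSup_nonneg fun j => Real.iSup_nonneg fun hj => ?_
    obtain ⟨hj1, hjn⟩ := Finset.mem_Icc.1 hj
    have hgap := hmono n (by omega) j (j + 1) hj1 (by omega) (by omega)
    refine div_nonneg ?_ (by unfold Hfun; positivity)
    unfold sgap mid
    linarith
  · filter_upwards [eventually_ge_atTop n₀] with n hn
    have hC : 0 ≤ ∑' z : ℤ, |(z : ℝ)| ^ (-β) := tsum_nonneg fun _ => by positivity
    have hnonneg : 0 ≤ 1 / (n : ℝ) +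
        B₂ / B₁ * (∑' z : ℤ, |(z : ℝ)| ^ (-β)) * (n : ℝ) ^ (-(1 + α₂ - β)) := by positivity
    refine Real.iSup_le (fun j => Real.iSup_le (fun hj => ?_) hnonneg) hnonneg
    obtain ⟨hj1, hjn⟩ := Finset.mem_Icc.1 hj
    have hn1 : 1 ≤ n := by omega
    have hn0 : (0 : ℝ) < n := by exact_mod_cast hn1
    refine sgap_div_Hfun_le b n j α₂ β B₁ B₂ hj1 (by omega) hβ₁ hB₁ (hmono n hn1)
      (fun k hk1 hkn => ?_) ?_
    · refine le_trans ?_ (hbound n hn j hj1 (by omega) k hk1 hkn).1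
      have hle : |((j : ℝ) - (k : ℝ)) / (n : ℝ)| ≤ 1 := by
        rw [abs_div, abs_of_pos hn0, div_le_one hn0, abs_le]
        have hj' : (j : ℝ) ≤ n := by exact_mod_cast (by omega : j ≤ n)
        have hk' : (k : ℝ) ≤ n := by exact_mod_cast hkn
        constructor <;> linarith [(j.cast_nonneg : (0 : ℝ) ≤ j), (k.cast_nonneg : (0 : ℝ) ≤ k)]
      exact mul_le_mul_of_nonneg_left
        (Real.rpow_le_rpow_of_exponent_ge_of_imp (abs_nonneg _) hle hβ
          fun _ h => absurd h (by linarith)) hB₁.le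
    · have h := (hbound n hn j hj1 (by omega) (j + 1) (by omega) (by omega)).2
      have habs : |((j : ℝ) - ((j + 1 : ℕ) : ℝ)) / (n : ℝ)| = (n : ℝ)⁻¹ := by
        rw [abs_div, abs_of_pos hn0]
        simp
      rw [habs, Real.inv_rpow hn0.le, ← Real.rpow_neg hn0.le, abs_sub_comm] at h
      exact (le_abs_self _).trans h
end
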